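/- Let d be a positive square-free integer with d ≠ 1 and d ≠ 3, and let K = ℚ(√−d) with ring of integers 𝒪_K. For every nonzero proper ideal π of 𝒪_K such that π and its conjugate π̄ are coprime and π² is principal, there exist unique integers a > 0 and b such that (a + b√−d)/2 is an algebraic integer generating the ideal π²; moreover the triple (N_{K/ℚ}(π), a, b) is then a solution of the equation 4n² = a² + d b² with n > 0, a > 0, b ≠ 0 and gcd(n, a) = 1, the resulting map is a bijection from the set of such ideals onto the set of solutions (n, a, b) of 4n² = a² + d b² with n > 0, a > 0, b ≠ 0 and gcd(n, a) = 1, and consequently F(d) = min{ n ∈ ℤ : n > 0 and there exist integers a > 0 and b ≠ 0 with 4n² = a² + d b² }. -/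

import Mathlib

set_option synthInstance.maxHeartbeats 400000
set_option maxHeartbeats 1000000

open NumberField

/-- For `z ∈ K^×`, the ideal `π_z = {x ∈ 𝒪_K | xz ∈ 𝒪_K}` of the ring of integers of a
number field `K` (`xz ∈ 𝒪_K` being expressed as `xz` integral over `ℤ`). -/
noncomputable def zIdeal (K : Type*) [Field K] [NumberField K] (z : K) :
    Ideal (𝓞 K) where
  carrier := {x | IsIntegral ℤ ((algebraMap (𝓞 K) K x) * z)}
  zero_mem' := by
    simp only [Set.mem_setOf_eq, map_zero, zero_mul]
    exact isIntegral_zero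
  add_mem' := by
    intro a b ha hb
    simp only [Set.mem_setOf_eq, map_add, add_mul] at *
    exact ha.add hb
  smul_mem' := by
    intro c x hx
    simp only [Set.mem_setOf_eq, smul_eq_mul, map_mul, mul_assoc] at *
    exact (RingOfIntegers.isIntegral_coe c).mul hx

/-- `F(d) = min_{z ∈ K₁ \ R} d(z)` where `K₁` is the group of norm-one elements of the
imaginary quadratic field `K = ℚ(√-d)` (the nontrivial element of `Gal(K/ℚ)` being `σ`),
`R` the roots of unity of `K`, and `d(z) = Card(𝒪_K/π_z)`. -/
noncomputable def Fquad (K : Type*) [Field K] [NumberField K] (σ : K ≃ₐ[ℚ] K) : ℕ :=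
  sInf {m : ℕ | ∃ z : K, z * σ z = 1 ∧ (¬ ∃ k : ℕ, 0 < k ∧ z ^ k = 1) ∧
    m = Nat.card ((𝓞 K) ⧸ zIdeal K z)}

/-- The set `𝒥` of nonzero proper ideals of `𝒪_K` that are coprime to their conjugate
and whose square is principal. -/
noncomputable def quadJ (K : Type*) [Field K] [NumberField K] (σ : K ≃ₐ[ℚ] K) :
    Set (Ideal (𝓞 K)) :=
  {π | π ≠ ⊥ ∧ π ≠ ⊤ ∧ π ⊔ Ideal.map (galRestrict ℤ ℚ K (𝓞 K) σ) π = ⊤ ∧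
    Submodule.IsPrincipal (π ^ 2 : Ideal (𝓞 K))}

/-- The automorphism of `𝓞 K` induced by an automorphism `σ` of `K`. -/
noncomputable abbrev conjInt {K : Type*} [Field K] [NumberField K] (σ : K ≃ₐ[ℚ] K) :
    𝓞 K ≃ₐ[ℤ] 𝓞 K :=
  galRestrict ℤ ℚ K (𝓞 K) σ

theorem coe_conjInt {K : Type*} [Field K] [NumberField K] (σ : K ≃ₐ[ℚ] K) (x : 𝓞 K) :
    algebraMap (𝓞 K) K (conjInt σ x) = σ (algebraMap (𝓞 K) K x) :=
  algebraMap_galRestrict_apply ℤ σ x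

theorem Ideal.absNorm_map_equiv {R : Type*} [CommRing R] [IsDedekindDomain R]
    [Module.Free ℤ R] (e : R ≃ₐ[ℤ] R) (I : Ideal R) :
    Ideal.absNorm (Ideal.map e I) = Ideal.absNorm I := by
  rw [Ideal.absNorm_apply, Ideal.absNorm_apply]
  exact (Nat.card_congr (Ideal.quotientEquiv I (Ideal.map e I) e.toRingEquiv rfl).toEquiv).symm

theorem exists_intCast_eq_of_squarefree_mul_sq {d : ℕ} (hd : Squarefree d) {y : ℚ}
    {m : ℤ} (h : (d : ℚ) * y ^ 2 = m) : ∃ b : ℤ, (b : ℚ) = y := by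
  have hint : IsIntegral ℤ ((d : ℚ) * y) := by
    apply IsIntegral.of_pow (n := 2) (by norm_num)
    have : ((d : ℚ) * y) ^ 2 = algebraMap ℤ ℚ (d * m) := by
      simp only [algebraMap_int_eq, eq_intCast]
      push_cast
      rw [← h]; ring
    rw [this]
    exact isIntegral_algebraMap
  obtain ⟨k, hk⟩ := IsIntegrallyClosed.isIntegral_iff.mp hint
  simp only [algebraMap_int_eq, eq_intCast] at hk
  have hk2 : k ^ 2 = d * m := by
    have : (k : ℚ) ^ 2 = d * m := by rw [hk, ← h]; ring
    exact_mod_cast this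
  have hdk : (d : ℤ) ∣ k :=
    ((Int.squarefree_natCast.mpr hd).dvd_pow_iff_dvd two_ne_zero).mp ⟨m, hk2⟩
  obtain ⟨c, rfl⟩ := hdk
  refine ⟨c, ?_⟩
  have hd0 : (d : ℚ) ≠ 0 := by exact_mod_cast hd.ne_zero
  apply mul_left_cancel₀ hd0
  rw [← hk]; push_cast; ring

section QuadraticField

variable {K : Type*} [Field K] [NumberField K] {d : ℕ} {sqd : K} {σ : K ≃ₐ[ℚ] K}

theorem sqrt_neg_ne_zero (hdpos : 0 < d) (hsq : sqd * sqd = -(d : K)) : sqd ≠ 0 := by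
  rintro rfl
  have : (d : K) ≠ 0 := by exact_mod_cast hdpos.ne'
  apply this
  linear_combination hsq

theorem rat_add_mul_sqrt_eq_zero (hdpos : 0 < d) (hsq : sqd * sqd = -(d : K))
    (hσ : σ sqd = -sqd) {p q : ℚ} (h : (p : K) + q * sqd = 0) : p = 0 ∧ q = 0 := by
  have h2 := congrArg σ h
  simp only [map_add, map_mul, hσ, map_ratCast, map_zero] at h2
  have hp : (p : K) = 0 := by linear_combination (h + h2) / 2
  have hq : (q : K) * sqd = 0 := by linear_combination (h - h2) / 2
  exact ⟨by exact_mod_cast hp,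
    by exact_mod_cast (mul_eq_zero.mp hq).resolve_right (sqrt_neg_ne_zero hdpos hsq)⟩

theorem exists_eq_rat_add_mul_sqrt (hrank : Module.finrank ℚ K = 2) (hdpos : 0 < d)
    (hsq : sqd * sqd = -(d : K)) (hσ : σ sqd = -sqd) (z : K) :
    ∃ p q : ℚ, z = p + q * sqd := by
  have hli : LinearIndependent ℚ ![(1 : K), sqd] := by
    rw [LinearIndependent.pair_iff]
    intro s t hst
    apply rat_add_mul_sqrt_eq_zero hdpos hsq hσ
    simpa [Algebra.smul_def] using hst
  have hspan := hli.span_eq_top_of_card_eq_finrank (by simp [hrank])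
  have hz : z ∈ Submodule.span ℚ (Set.range ![(1 : K), sqd]) := hspan ▸ Submodule.mem_top
  rw [Matrix.range_cons, Matrix.range_cons, Matrix.range_empty, Set.union_empty,
    Set.singleton_union, Submodule.mem_span_pair] at hz
  obtain ⟨p, q, rfl⟩ := hz
  exact ⟨p, q, by simp [Algebra.smul_def]⟩

theorem conj_conj (hrank : Module.finrank ℚ K = 2) (hdpos : 0 < d)
    (hsq : sqd * sqd = -(d : K)) (hσ : σ sqd = -sqd) (z : K) : σ (σ z) = z := by
  obtain ⟨p, q, rfl⟩ := exists_eq_rat_add_mul_sqrt hrank hdpos hsq hσ z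
  simp [hσ]

theorem conjInt_conjInt (hrank : Module.finrank ℚ K = 2) (hdpos : 0 < d)
    (hsq : sqd * sqd = -(d : K)) (hσ : σ sqd = -sqd) (x : 𝓞 K) :
    conjInt σ (conjInt σ x) = x := by
  apply RingOfIntegers.coe_injective
  rw [coe_conjInt, coe_conjInt, conj_conj hrank hdpos hsq hσ]

theorem map_conjInt_map_conjInt (hrank : Module.finrank ℚ K = 2) (hdpos : 0 < d)
    (hsq : sqd * sqd = -(d : K)) (hσ : σ sqd = -sqd) (I : Ideal (𝓞 K)) :
    Ideal.map (conjInt σ) (Ideal.map (conjInt σ) I) = I := by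
  apply le_antisymm
  · rw [Ideal.map_le_iff_le_comap, Ideal.map_le_iff_le_comap]
    intro x hx
    simpa only [Ideal.mem_comap, conjInt_conjInt hrank hdpos hsq hσ] using hx
  · intro x hx
    rw [← conjInt_conjInt hrank hdpos hsq hσ x]
    exact Ideal.mem_map_of_mem _ (Ideal.mem_map_of_mem _ hx)

theorem half_add_mul_sqrt_injective (hdpos : 0 < d) (hsq : sqd * sqd = -(d : K))
    (hσ : σ sqd = -sqd) {a b a' b' : ℤ}
    (h : ((a : K) + b * sqd) / 2 = ((a' : K) + b' * sqd) / 2) : a = a' ∧ b = b' := by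
  have h0 : (((a - a' : ℤ) : ℚ) : K) + ((b - b' : ℤ) : ℚ) * sqd = 0 := by
    push_cast
    linear_combination 2 * h
  obtain ⟨h1, h2⟩ := rat_add_mul_sqrt_eq_zero hdpos hsq hσ h0
  exact ⟨sub_eq_zero.mp (by exact_mod_cast h1), sub_eq_zero.mp (by exact_mod_cast h2)⟩

theorem conj_half (hσ : σ sqd = -sqd) (a b : ℤ) :
    σ (((a : K) + b * sqd) / 2) = ((a : K) - b * sqd) / 2 := by
  simp only [map_div₀, map_add, map_mul, hσ, map_intCast, map_ofNat]
  ring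

theorem exists_int_of_isIntegral_ratCast {p : ℚ} (h : IsIntegral ℤ (p : K)) :
    ∃ a : ℤ, (a : ℚ) = p := by
  have : IsIntegral ℤ p := by
    rw [← isIntegral_algebraMap_iff (algebraMap ℚ K).injective]
    simpa using h
  obtain ⟨k, hk⟩ := IsIntegrallyClosed.isIntegral_iff.mp this
  exact ⟨k, by simpa using hk⟩

theorem exists_eq_half_add_mul_sqrt (hd : Squarefree d) (hrank : Module.finrank ℚ K = 2)
    (hdpos : 0 < d) (hsq : sqd * sqd = -(d : K)) (hσ : σ sqd = -sqd) (x : 𝓞 K) :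
    ∃ a b : ℤ, algebraMap (𝓞 K) K x = ((a : K) + b * sqd) / 2 := by
  obtain ⟨p, q, hx⟩ := exists_eq_rat_add_mul_sqrt hrank hdpos hsq hσ (algebraMap (𝓞 K) K x)
  have hy : algebraMap (𝓞 K) K (conjInt σ x) = p - q * sqd := by
    rw [coe_conjInt, hx]
    simp only [map_add, map_mul, hσ, map_ratCast]
    ring
  have h1 : IsIntegral ℤ ((2 * p : ℚ) : K) := by
    have := RingOfIntegers.isIntegral_coe (x + conjInt σ x)
    rw [map_add, hx, hy] at this
    convert this using 1
    push_cast; ring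
  have h2 : IsIntegral ℤ (((d : ℚ) * (2 * q) ^ 2 : ℚ) : K) := by
    have := RingOfIntegers.isIntegral_coe (-(x - conjInt σ x) ^ 2)
    rw [map_neg, map_pow, map_sub, hx, hy] at this
    convert this using 1
    push_cast
    linear_combination (4 * (q : K) ^ 2) * hsq
  obtain ⟨a, ha⟩ := exists_int_of_isIntegral_ratCast h1
  obtain ⟨m, hm⟩ := exists_int_of_isIntegral_ratCast h2
  obtain ⟨b, hb⟩ := exists_intCast_eq_of_squarefree_mul_sq hd hm.symm
  refine ⟨a, b, ?_⟩
  rw [hx]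
  have ha' : (a : K) = 2 * p := by exact_mod_cast congrArg (Rat.cast : ℚ → K) ha
  have hb' : (b : K) = 2 * q := by exact_mod_cast congrArg (Rat.cast : ℚ → K) hb
  rw [ha', hb']
  ring

/-- The norm form: if `x = (a + b√-d)/2`, then `4 x x̄ = a² + d b²`. -/
theorem four_mul_norm_half (hsq : sqd * sqd = -(d : K)) (hσ : σ sqd = -sqd)
    (a b : ℤ) {z : K} (hz : z = ((a : K) + b * sqd) / 2) :
    4 * (z * σ z) = ((a ^ 2 + d * b ^ 2 : ℤ) : K) := by
  rw [hz, conj_half hσ]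
  push_cast
  linear_combination (-(b : K) ^ 2) * hsq

theorem exists_mul_conjInt_eq (hd : Squarefree d) (hrank : Module.finrank ℚ K = 2)
    (hdpos : 0 < d) (hsq : sqd * sqd = -(d : K)) (hσ : σ sqd = -sqd) (x : 𝓞 K) :
    ∃ m : ℕ, x * conjInt σ x = (m : 𝓞 K) := by
  obtain ⟨a, b, hx⟩ := exists_eq_half_add_mul_sqrt hd hrank hdpos hsq hσ x
  have h := four_mul_norm_half hsq hσ a b hx
  have hr : (((a ^ 2 + d * b ^ 2 : ℤ) / 4 : ℚ) : K) = algebraMap (𝓞 K) K (x * conjInt σ x) := by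
    rw [map_mul, coe_conjInt]
    push_cast at h ⊢
    linear_combination -h / 4
  obtain ⟨m, hm⟩ := exists_int_of_isIntegral_ratCast
    (hr ▸ RingOfIntegers.isIntegral_coe (x * conjInt σ x))
  have hm0 : 0 ≤ m := by
    have : (0 : ℚ) ≤ m := by rw [hm]; push_cast; positivity
    exact_mod_cast this
  lift m to ℕ using hm0
  refine ⟨m, RingOfIntegers.coe_injective ?_⟩
  rw [← hr, ← hm, map_natCast]
  norm_cast

theorem absNorm_span_eq_of_mul_conjInt (hrank : Module.finrank ℚ K = 2) {x : 𝓞 K} {m : ℕ}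
    (h : x * conjInt σ x = (m : 𝓞 K)) : Ideal.absNorm (Ideal.span {x}) = m := by
  have h1 : Ideal.span {x} * Ideal.map (conjInt σ) (Ideal.span {x}) = Ideal.span {(m : 𝓞 K)} := by
    rw [Ideal.map_span, Set.image_singleton, Ideal.span_singleton_mul_span_singleton, h]
  have h2 := congrArg Ideal.absNorm h1
  rw [map_mul, Ideal.absNorm_map_equiv, Ideal.absNorm_span_natCast, RingOfIntegers.rank, hrank,
    ← sq] at h2
  exact Nat.pow_left_injective (n := 2) two_ne_zero h2

theorem mul_conjInt_eq_absNorm_span (hd : Squarefree d) (hrank : Module.finrank ℚ K = 2)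
    (hdpos : 0 < d) (hsq : sqd * sqd = -(d : K)) (hσ : σ sqd = -sqd) (x : 𝓞 K) :
    x * conjInt σ x = (Ideal.absNorm (Ideal.span {x}) : 𝓞 K) := by
  obtain ⟨m, hm⟩ := exists_mul_conjInt_eq hd hrank hdpos hsq hσ x
  rw [absNorm_span_eq_of_mul_conjInt hrank hm, hm]

theorem four_mul_absNorm_span (hd : Squarefree d) (hrank : Module.finrank ℚ K = 2)
    (hdpos : 0 < d) (hsq : sqd * sqd = -(d : K)) (hσ : σ sqd = -sqd) {x : 𝓞 K} {a b : ℤ}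
    (hx : algebraMap (𝓞 K) K x = ((a : K) + b * sqd) / 2) :
    4 * (Ideal.absNorm (Ideal.span {x}) : ℤ) = a ^ 2 + d * b ^ 2 := by
  have h := four_mul_norm_half hsq hσ a b hx
  have h1 := congrArg (algebraMap (𝓞 K) K) (mul_conjInt_eq_absNorm_span hd hrank hdpos hsq hσ x)
  rw [map_mul, coe_conjInt, map_natCast] at h1
  rw [h1] at h
  exact_mod_cast h

theorem eq_one_or_neg_one_of_isUnit (hd : Squarefree d) (hd1 : d ≠ 1) (hd3 : d ≠ 3)
    (hrank : Module.finrank ℚ K = 2) (hdpos : 0 < d) (hsq : sqd * sqd = -(d : K))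
    (hσ : σ sqd = -sqd) {u : 𝓞 K} (hu : IsUnit u) : u = 1 ∨ u = -1 := by
  obtain ⟨a, b, hab⟩ := exists_eq_half_add_mul_sqrt hd hrank hdpos hsq hσ u
  have h := four_mul_absNorm_span hd hrank hdpos hsq hσ hab
  rw [Ideal.span_singleton_eq_top.mpr hu, Ideal.absNorm_top] at h
  push_cast at h
  have hb : b = 0 := by
    by_contra hb
    have hb1 : 1 ≤ b ^ 2 := Int.one_le_abs hb |>.trans (by nlinarith [sq_abs b, Int.one_le_abs hb])
    have hd4 : d ≤ 4 := by
      have : (d : ℤ) ≤ 4 := by nlinarith [sq_nonneg a]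
      exact_mod_cast this
    have ha2 : a ^ 2 ≤ 4 := by nlinarith
    have hal : -2 ≤ a := by nlinarith
    have hau : a ≤ 2 := by nlinarith
    have hb2 : b ^ 2 ≤ 4 := by nlinarith [sq_nonneg a]
    have hbl : -2 ≤ b := by nlinarith
    have hbu : b ≤ 2 := by nlinarith
    have hd' : d = 2 ∨ d = 4 := by omega
    rcases hd' with rfl | rfl
    · interval_cases b <;> interval_cases a <;> first | exact hb rfl | simp at h
    · exact absurd (hd 2 (by norm_num)) (by simp)
  subst hb
  have ha : (a - 2) * (a + 2) = 0 := by linarith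
  rcases mul_eq_zero.mp ha with ha | ha
  · left
    apply RingOfIntegers.coe_injective
    rw [hab, show a = 2 by omega]
    simp
  · right
    apply RingOfIntegers.coe_injective
    rw [hab, show a = -2 by omega]
    simp

theorem add_conjInt_of_eq_half (hσ : σ sqd = -sqd) {x : 𝓞 K} {a b : ℤ}
    (hx : algebraMap (𝓞 K) K x = ((a : K) + b * sqd) / 2) :
    x + conjInt σ x = (a : 𝓞 K) := by
  apply RingOfIntegers.coe_injective
  rw [map_add, coe_conjInt, hx, conj_half hσ, map_intCast]
  ring

theorem fst_ne_zero_and_snd_ne_zero_of_isCoprime (hσ : σ sqd = -sqd) {x : 𝓞 K}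
    (hcop : IsCoprime x (conjInt σ x)) (hu : ¬ IsUnit x) {a b : ℤ}
    (hx : algebraMap (𝓞 K) K x = ((a : K) + b * sqd) / 2) : a ≠ 0 ∧ b ≠ 0 := by
  constructor
  · rintro rfl
    have h := add_conjInt_of_eq_half hσ hx
    rw [Int.cast_zero] at h
    rw [← neg_eq_of_add_eq_zero_right h, IsCoprime.neg_right_iff, isCoprime_self] at hcop
    exact hu hcop
  · rintro rfl
    have h : conjInt σ x = x := by
      apply RingOfIntegers.coe_injective
      rw [coe_conjInt, hx, conj_half hσ]
      simp
    rw [h, isCoprime_self] at hcop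
    exact hu hcop

theorem isCoprime_conjInt_of_mem_quadJ {π : Ideal (𝓞 K)} (hπ : π ∈ quadJ K σ) {x : 𝓞 K}
    (hx : Ideal.span {x} = π ^ 2) : IsCoprime x (conjInt σ x) ∧ ¬ IsUnit x := by
  obtain ⟨-, htop, hcop, -⟩ := hπ
  constructor
  · rw [← Ideal.isCoprime_span_singleton_iff, ← Set.image_singleton (f := conjInt σ),
      ← Ideal.map_span, hx, Ideal.map_pow]
    exact (Ideal.isCoprime_iff_sup_eq.mpr hcop).pow
  · intro hu
    rw [Ideal.span_singleton_eq_top.mpr hu] at hx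
    apply htop
    rw [← Ideal.one_eq_top] at hx ⊢
    exact isUnit_iff_eq_one.mp ((isUnit_pow_iff two_ne_zero).mp (hx ▸ isUnit_one))

theorem isUnit_natCast_ringOfIntegers_iff (hrank : Module.finrank ℚ K = 2) {g : ℕ} :
    IsUnit (g : 𝓞 K) ↔ g = 1 := by
  constructor
  · intro h
    have h1 := Ideal.absNorm_span_natCast (S := 𝓞 K) g
    rw [Ideal.span_singleton_eq_top.mpr h, Ideal.absNorm_top, RingOfIntegers.rank, hrank] at h1
    exact (Nat.pow_eq_one.mp h1.symm).resolve_right two_ne_zero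
  · rintro rfl
    simp

theorem existsUnique_generator (hd : Squarefree d) (hd1 : d ≠ 1) (hd3 : d ≠ 3)
    (hrank : Module.finrank ℚ K = 2) (hdpos : 0 < d) (hsq : sqd * sqd = -(d : K))
    (hσ : σ sqd = -sqd) {π : Ideal (𝓞 K)} (hπ : π ∈ quadJ K σ) :
    ∃! ab : ℤ × ℤ, 0 < ab.1 ∧ ∃ x : 𝓞 K,
      algebraMap (𝓞 K) K x = ((ab.1 : K) + (ab.2 : K) * sqd) / 2 ∧
      Ideal.span {x} = π ^ 2 := by
  obtain ⟨x, hx⟩ := hπ.2.2.2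
  change π ^ 2 = Ideal.span {x} at hx
  obtain ⟨hcop, hu⟩ := isCoprime_conjInt_of_mem_quadJ hπ hx.symm
  obtain ⟨a, b, hab⟩ := exists_eq_half_add_mul_sqrt hd hrank hdpos hsq hσ x
  obtain ⟨ha, -⟩ := fst_ne_zero_and_snd_ne_zero_of_isCoprime hσ hcop hu hab
  have hneg : algebraMap (𝓞 K) K (-x) = (((-a : ℤ) : K) + ((-b : ℤ) : K) * sqd) / 2 := by
    rw [map_neg, hab]; push_cast; ring
  apply existsUnique_of_exists_of_unique
  · rcases lt_or_gt_of_ne ha with ha | ha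
    · exact ⟨(-a, -b), neg_pos.mpr ha, -x, hneg, by rw [Ideal.span_singleton_neg, hx]⟩
    · exact ⟨(a, b), ha, x, hab, hx.symm⟩
  · rintro ⟨a₁, b₁⟩ ⟨a₂, b₂⟩ ⟨h₁, x₁, hx₁, hs₁⟩ ⟨h₂, x₂, hx₂, hs₂⟩
    simp only at h₁ h₂ hx₁ hx₂
    obtain ⟨u, rfl⟩ := Ideal.span_singleton_eq_span_singleton.mp (hs₁.trans hs₂.symm)
    rcases eq_one_or_neg_one_of_isUnit hd hd1 hd3 hrank hdpos hsq hσ u.isUnit with hu | hu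
    · rw [hu, mul_one, hx₁] at hx₂
      obtain ⟨rfl, rfl⟩ := half_add_mul_sqrt_injective hdpos hsq hσ hx₂
      rfl
    · rw [hu, map_mul, map_neg, map_one, hx₁] at hx₂
      have : (((-a₁ : ℤ) : K) + ((-b₁ : ℤ) : K) * sqd) / 2 = ((a₂ : K) + b₂ * sqd) / 2 := by
        rw [← hx₂]; push_cast; ring
      have := (half_add_mul_sqrt_injective hdpos hsq hσ this).1
      omega

theorem isPrimitiveSolution_of_mem_quadJ (hd : Squarefree d) (hrank : Module.finrank ℚ K = 2)
    (hdpos : 0 < d) (hsq : sqd * sqd = -(d : K)) (hσ : σ sqd = -sqd) {π : Ideal (𝓞 K)}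
    (hπ : π ∈ quadJ K σ) {a b : ℤ} {x : 𝓞 K}
    (hab : algebraMap (𝓞 K) K x = ((a : K) + (b : K) * sqd) / 2)
    (hx : Ideal.span {x} = π ^ 2) :
    b ≠ 0 ∧ 4 * (Ideal.absNorm π : ℤ) ^ 2 = a ^ 2 + (d : ℤ) * b ^ 2 ∧
      Int.gcd (Ideal.absNorm π : ℤ) a = 1 := by
  obtain ⟨hcop, hu⟩ := isCoprime_conjInt_of_mem_quadJ hπ hx
  refine ⟨(fst_ne_zero_and_snd_ne_zero_of_isCoprime hσ hcop hu hab).2, ?_, ?_⟩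
  · rw [← four_mul_absNorm_span hd hrank hdpos hsq hσ hab, hx, map_pow]
    push_cast
    rfl
  · have hsum := add_conjInt_of_eq_half hσ hab
    have hprod := mul_conjInt_eq_absNorm_span hd hrank hdpos hsq hσ x
    rw [hx, map_pow, Nat.cast_pow] at hprod
    obtain ⟨u, v, huv⟩ := hcop
    have h1 : IsCoprime (x + conjInt σ x) (x * conjInt σ x) :=
      IsCoprime.mul_right ⟨v, u - v, by linear_combination huv⟩
        ⟨u, v - u, by linear_combination huv⟩
    rw [hsum, hprod] at h1
    have h2 : IsCoprime (a : 𝓞 K) (Ideal.absNorm π : 𝓞 K) :=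
      (IsCoprime.pow_right_iff two_pos).mp h1
    rw [← isUnit_natCast_ringOfIntegers_iff hrank]
    apply h2.isUnit_of_dvd'
    · simpa using map_dvd (Int.castRingHom (𝓞 K)) (Int.gcd_dvd_right (Ideal.absNorm π : ℤ) a)
    · simpa using map_dvd (Int.castRingHom (𝓞 K)) (Int.gcd_dvd_left (Ideal.absNorm π : ℤ) a)

theorem exists_ringOfIntegers_eq_half (hsq : sqd * sqd = -(d : K)) {n a b : ℤ}
    (h : 4 * n ^ 2 = a ^ 2 + (d : ℤ) * b ^ 2) :
    ∃ x : 𝓞 K, algebraMap (𝓞 K) K x = ((a : K) + (b : K) * sqd) / 2 := by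
  have hint : IsIntegral ℤ (((a : K) + (b : K) * sqd) / 2) := by
    refine ⟨Polynomial.X ^ 2 - Polynomial.C a * Polynomial.X + Polynomial.C (n ^ 2),
      by monicity!, ?_⟩
    have hK : 4 * (n : K) ^ 2 = a ^ 2 + d * b ^ 2 := by exact_mod_cast congrArg (Int.cast : ℤ → K) h
    simp only [Polynomial.eval₂_add, Polynomial.eval₂_sub, Polynomial.eval₂_mul,
      Polynomial.eval₂_pow, Polynomial.eval₂_X, Polynomial.eval₂_C]
    simp only [algebraMap_int_eq, eq_intCast, Int.cast_pow]
    linear_combination hK / 4 + (b : K) ^ 2 / 4 * hsq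
  exact ⟨⟨_, hint⟩, rfl⟩

theorem mul_conjInt_eq_sq (hsq : sqd * sqd = -(d : K)) (hσ : σ sqd = -sqd) {n a b : ℤ}
    (h : 4 * n ^ 2 = a ^ 2 + (d : ℤ) * b ^ 2) {x : 𝓞 K}
    (hx : algebraMap (𝓞 K) K x = ((a : K) + (b : K) * sqd) / 2) :
    x * conjInt σ x = (n : 𝓞 K) ^ 2 := by
  apply RingOfIntegers.coe_injective
  have h1 := four_mul_norm_half hsq hσ a b hx
  rw [← h] at h1
  rw [map_mul, coe_conjInt, map_pow, map_intCast]
  push_cast at h1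
  linear_combination h1 / 4

theorem not_root_of_unity_div (hd : Squarefree d) (hd1 : d ≠ 1) (hd3 : d ≠ 3)
    (hrank : Module.finrank ℚ K = 2) (hdpos : 0 < d) (hsq : sqd * sqd = -(d : K))
    (hσ : σ sqd = -sqd) {n : ℕ} (hn : 0 < n) {a b : ℤ} (hb : b ≠ 0) :
    ¬ ∃ k : ℕ, 0 < k ∧ (((a : K) + (b : K) * sqd) / 2 / n) ^ k = 1 := by
  rintro ⟨k, hk, hzk⟩
  have hnK : (n : K) ≠ 0 := by exact_mod_cast hn.ne'
  have hint : IsIntegral ℤ (((a : K) + (b : K) * sqd) / 2 / n) :=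
    IsIntegral.of_pow hk (hzk ▸ isIntegral_one)
  obtain ⟨y, hy⟩ : ∃ y : 𝓞 K, algebraMap (𝓞 K) K y = ((a : K) + (b : K) * sqd) / 2 / n :=
    ⟨⟨_, hint⟩, rfl⟩
  have hyk : y ^ k = 1 := RingOfIntegers.coe_injective (by rw [map_pow, hy, hzk, map_one])
  have key : ∀ c : ℤ, ((a : K) + (b : K) * sqd) / 2 / n = c → False := by
    intro c hc
    have h1 : ((a : K) + (b : K) * sqd) / 2 =
        (((2 * n * c : ℤ) : K) + ((0 : ℤ) : K) * sqd) / 2 := by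
      rw [div_eq_iff hnK] at hc
      rw [hc]; push_cast; ring
    exact hb (half_add_mul_sqrt_injective hdpos hsq hσ h1).2
  rcases eq_one_or_neg_one_of_isUnit hd hd1 hd3 hrank hdpos hsq hσ
    (IsUnit.of_pow_eq_one hyk hk.ne') with rfl | rfl
  · exact key 1 (by rw [← hy]; simp)
  · exact key (-1) (by rw [← hy]; simp)

theorem existsUnique_ideal_of_primitiveSolution (hd : Squarefree d) (hd1 : d ≠ 1)
    (hd3 : d ≠ 3) (hrank : Module.finrank ℚ K = 2) (hdpos : 0 < d)
    (hsq : sqd * sqd = -(d : K)) (hσ : σ sqd = -sqd) {n a b : ℤ}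
    (hn : 0 < n) (hb : b ≠ 0) (h : 4 * n ^ 2 = a ^ 2 + (d : ℤ) * b ^ 2)
    (hgcd : Int.gcd n a = 1) :
    ∃! π : Ideal (𝓞 K), π ∈ quadJ K σ ∧ (Ideal.absNorm π : ℤ) = n ∧
      ∃ x : 𝓞 K, algebraMap (𝓞 K) K x = ((a : K) + (b : K) * sqd) / 2 ∧
        Ideal.span {x} = π ^ 2 := by
  obtain ⟨x, hx⟩ := exists_ringOfIntegers_eq_half (K := K) hsq h
  have hsum := add_conjInt_of_eq_half hσ hx
  have hprod := mul_conjInt_eq_sq hsq hσ h hx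
  have hcop : IsCoprime x (conjInt σ x) := by
    have h1 : IsCoprime (a : 𝓞 K) ((n : 𝓞 K) ^ 2) :=
      ((Int.isCoprime_iff_gcd_eq_one.mpr hgcd).symm.map (Int.castRingHom (𝓞 K))).pow_right
    rw [← hsum, ← hprod] at h1
    obtain ⟨u, v, huv⟩ := h1
    exact ⟨u + v * conjInt σ x, u, by linear_combination huv⟩
  have hideal : Ideal.span {x} * Ideal.span {conjInt σ x} = Ideal.span {(n : 𝓞 K)} ^ 2 := by
    rw [Ideal.span_singleton_mul_span_singleton, hprod, Ideal.span_singleton_pow]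
  obtain ⟨π, hπ⟩ := exists_eq_pow_of_mul_eq_pow_of_coprime
    ((Ideal.isCoprime_span_singleton_iff _ _).mpr hcop) hideal
  have hnorm : Ideal.absNorm π = n.toNat := by
    lift n to ℕ using hn.le
    have h1 := absNorm_span_eq_of_mul_conjInt (σ := σ) hrank (x := x) (m := n ^ 2)
      (by rw [hprod]; push_cast; rfl)
    rw [hπ, map_pow] at h1
    exact Nat.pow_left_injective (n := 2) two_ne_zero h1
  have hx0 : x ≠ 0 := by
    rintro rfl
    rw [zero_mul] at hprod
    exact hn.ne' (by exact_mod_cast pow_eq_zero_iff two_ne_zero |>.mp hprod.symm)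
  have hmem : π ∈ quadJ K σ := by
    refine ⟨?_, ?_, ?_, ⟨x, hπ.symm⟩⟩
    · rintro rfl
      rw [← Ideal.zero_eq_bot, zero_pow two_ne_zero, Ideal.zero_eq_bot,
        Ideal.span_singleton_eq_bot] at hπ
      exact hx0 hπ
    · rintro rfl
      rw [← Ideal.one_eq_top, one_pow, Ideal.one_eq_top, Ideal.span_singleton_eq_top] at hπ
      have hx2 : x ^ 2 = 1 := by
        rcases eq_one_or_neg_one_of_isUnit hd hd1 hd3 hrank hdpos hsq hσ hπ with h1 | h1 <;>
          simp [h1]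
      apply not_root_of_unity_div hd hd1 hd3 hrank hdpos hsq hσ one_pos (a := a) hb
      exact ⟨2, two_pos, by rw [Nat.cast_one, div_one, ← hx, ← map_pow, hx2, map_one]⟩
    · have h2 := (Ideal.isCoprime_span_singleton_iff _ _).mpr hcop
      rw [← Set.image_singleton (f := conjInt σ), ← Ideal.map_span, hπ, Ideal.map_pow,
        IsCoprime.pow_iff two_pos two_pos] at h2
      exact h2.sup_eq
  refine ⟨π, ⟨hmem, by rw [hnorm, Int.toNat_of_nonneg hn.le], x, hx, hπ⟩, ?_⟩
  rintro π' ⟨-, -, x', hx', hπ'⟩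
  obtain rfl : x' = x := RingOfIntegers.coe_injective (hx'.trans hx.symm)
  exact pow_left_injective two_ne_zero (hπ'.symm.trans hπ)

theorem zIdeal_ne_bot (z : K) : zIdeal K z ≠ ⊥ := by
  obtain ⟨m, hm0, hm⟩ :=
    ((IsFractionRing.isAlgebraic_iff ℤ ℚ K).mpr
      (Algebra.IsAlgebraic.isAlgebraic z)).exists_integral_multiple
  intro h
  have : (m : 𝓞 K) ∈ zIdeal K z := by
    change IsIntegral ℤ _
    rw [map_intCast]
    simpa using hm
  rw [h, Ideal.mem_bot] at this
  exact hm0 (by exact_mod_cast this)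

theorem exists_solution_of_norm_one (hd : Squarefree d) (hrank : Module.finrank ℚ K = 2)
    (hdpos : 0 < d) (hsq : sqd * sqd = -(d : K)) (hσ : σ sqd = -sqd) {z : K}
    (hz : z * σ z = 1) (hroot : ¬ ∃ k : ℕ, 0 < k ∧ z ^ k = 1) :
    0 < Ideal.absNorm (zIdeal K z) ∧ ∃ a b : ℤ, 0 < a ∧ b ≠ 0 ∧
      4 * (Ideal.absNorm (zIdeal K z) : ℤ) ^ 2 = a ^ 2 + (d : ℤ) * b ^ 2 := by
  have hpos : 0 < Ideal.absNorm (zIdeal K z) :=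
    Nat.pos_of_ne_zero (Ideal.absNorm_eq_zero_iff.not.mpr (zIdeal_ne_bot z))
  have hint : IsIntegral ℤ (algebraMap (𝓞 K) K (Ideal.absNorm (zIdeal K z)) * z) :=
    Ideal.absNorm_mem (zIdeal K z)
  rw [map_natCast] at hint
  generalize Ideal.absNorm (zIdeal K z) = N at hpos hint
  have hN : (N : K) ≠ 0 := by exact_mod_cast hpos.ne'
  obtain ⟨x, hx⟩ : ∃ x : 𝓞 K, algebraMap (𝓞 K) K x = N * z := ⟨⟨_, hint⟩, rfl⟩
  obtain ⟨a, b, hab⟩ := exists_eq_half_add_mul_sqrt hd hrank hdpos hsq hσ x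
  have hconj : (N : K) * σ z = ((a : K) - b * sqd) / 2 := by
    rw [← conj_half hσ, ← hab, hx, map_mul, map_natCast]
  rw [hx] at hab
  refine ⟨hpos, |a|, b, abs_pos.mpr ?_, ?_, ?_⟩
  · rintro rfl
    have h1 : σ z = -z := by
      apply mul_left_cancel₀ hN
      rw [hconj, mul_neg, hab]
      push_cast; ring
    rw [h1] at hz
    exact hroot ⟨4, by norm_num, by linear_combination (1 - z ^ 2) * hz⟩
  · rintro rfl
    have h1 : σ z = z := by
      apply mul_left_cancel₀ hN
      rw [hconj, hab]
      push_cast; ring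
    rw [h1] at hz
    exact hroot ⟨2, by norm_num, by linear_combination hz⟩
  · rw [sq_abs]
    have h1 := four_mul_norm_half hsq hσ a b (hx.trans hab)
    rw [hx, map_mul, map_natCast] at h1
    have h2 : (4 * (N : K) ^ 2) = ((a ^ 2 + d * b ^ 2 : ℤ) : K) := by
      rw [← h1]; linear_combination (-4 * (N : K) ^ 2) * hz
    exact_mod_cast h2

theorem absNorm_zIdeal_le (hrank : Module.finrank ℚ K = 2) {n : ℕ} (hn : 0 < n) {x : 𝓞 K}
    (hx : x * conjInt σ x = (n : 𝓞 K) ^ 2) :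
    Ideal.absNorm (zIdeal K (algebraMap (𝓞 K) K x / n)) ≤ n := by
  have hnO : (n : 𝓞 K) ≠ 0 := by exact_mod_cast hn.ne'
  have hnK : (n : K) ≠ 0 := by exact_mod_cast hn.ne'
  set g : Ideal (𝓞 K) := Ideal.span {x, (n : 𝓞 K)} with hg
  obtain ⟨h, hgh⟩ : g ∣ Ideal.span {(n : 𝓞 K)} :=
    Ideal.dvd_iff_le.mpr (Ideal.span_mono (by simp))
  have hle : h ≤ zIdeal K (algebraMap (𝓞 K) K x / n) := by
    intro y hy
    have hxy : x * y ∈ Ideal.span {(n : 𝓞 K)} :=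
      hgh ▸ Ideal.mul_mem_mul (Ideal.subset_span (by simp)) hy
    obtain ⟨w, hw⟩ := Ideal.mem_span_singleton'.mp hxy
    change IsIntegral ℤ _
    have : algebraMap (𝓞 K) K y * (algebraMap (𝓞 K) K x / n) = algebraMap (𝓞 K) K w := by
      have hw' := congrArg (algebraMap (𝓞 K) K) hw
      rw [map_mul, map_mul, map_natCast] at hw'
      field_simp
      linear_combination -hw'
    rw [this]
    exact RingOfIntegers.isIntegral_coe w
  have hconj : g * Ideal.map (conjInt σ) g ≤ Ideal.span {(n : 𝓞 K)} := by
    rw [hg, Ideal.map_span, Set.image_pair, map_natCast, Ideal.mul_le]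
    intro r hr s hs
    obtain ⟨α, β, rfl⟩ := Ideal.mem_span_pair.mp hr
    obtain ⟨γ, δ, rfl⟩ := Ideal.mem_span_pair.mp hs
    rw [Ideal.mem_span_singleton']
    exact ⟨α * γ * n + α * x * δ + β * γ * conjInt σ x + β * δ * n,
      by linear_combination (-α * γ) * hx⟩
  have hnorm : Ideal.absNorm g * Ideal.absNorm h = n ^ 2 := by
    rw [← map_mul, ← hgh, Ideal.absNorm_span_natCast, RingOfIntegers.rank, hrank]
  have hdvd : n ∣ Ideal.absNorm g := by
    have h1 := Ideal.absNorm_dvd_absNorm_of_le hconj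
    rw [map_mul, Ideal.absNorm_map_equiv, Ideal.absNorm_span_natCast, RingOfIntegers.rank, hrank,
      ← sq] at h1
    exact (Nat.pow_dvd_pow_iff two_ne_zero).mp h1
  obtain ⟨k, hk⟩ := hdvd
  have hkh : k * Ideal.absNorm h = n := by
    apply Nat.eq_of_mul_eq_mul_left hn
    rw [← mul_assoc, ← hk, hnorm, sq]
  exact Nat.le_of_dvd hn
    ((Ideal.absNorm_dvd_absNorm_of_le hle).trans (Dvd.intro_left k hkh))

theorem Nat.sInf_eq_sInf_of_subset {A B : Set ℕ} (hAB : A ⊆ B)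
    (hBA : ∀ n ∈ B, ∃ m ∈ A, m ≤ n) : sInf A = sInf B := by
  rcases B.eq_empty_or_nonempty with rfl | hB
  · rw [Set.subset_empty_iff.mp hAB]
  · obtain ⟨m, hm, hle⟩ := hBA _ (Nat.sInf_mem hB)
    exact le_antisymm ((Nat.sInf_le hm).trans hle) (Nat.sInf_le (hAB (Nat.sInf_mem ⟨m, hm⟩)))

theorem Fquad_eq_sInf (hd : Squarefree d) (hd1 : d ≠ 1) (hd3 : d ≠ 3)
    (hrank : Module.finrank ℚ K = 2) (hdpos : 0 < d) (hsq : sqd * sqd = -(d : K))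
    (hσ : σ sqd = -sqd) :
    Fquad K σ = sInf {n : ℕ | 0 < n ∧ ∃ a b : ℤ, 0 < a ∧ b ≠ 0 ∧
      4 * (n : ℤ) ^ 2 = a ^ 2 + (d : ℤ) * b ^ 2} := by
  apply Nat.sInf_eq_sInf_of_subset
  · rintro m ⟨z, hz, hroot, rfl⟩
    exact exists_solution_of_norm_one hd hrank hdpos hsq hσ hz hroot
  · rintro n ⟨hn, a, b, -, hb, h⟩
    obtain ⟨x, hx⟩ := exists_ringOfIntegers_eq_half (K := K) hsq h
    have hprod := mul_conjInt_eq_sq hsq hσ h hx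
    rw [Int.cast_natCast] at hprod
    refine ⟨_, ⟨algebraMap (𝓞 K) K x / n, ?_, ?_, rfl⟩,
      absNorm_zIdeal_le hrank hn hprod⟩
    · have hnK : (n : K) ≠ 0 := by exact_mod_cast hn.ne'
      have h1 := congrArg (algebraMap (𝓞 K) K) hprod
      rw [map_mul, map_pow, map_natCast, coe_conjInt] at h1
      rw [map_div₀, map_natCast, div_mul_div_comm, h1, sq, div_self (mul_ne_zero hnK hnK)]
    · rw [hx]
      exact not_root_of_unity_div hd hd1 hd3 hrank hdpos hsq hσ hn hb

end QuadraticField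

/-- Let `d ≠ 1, 3` be a positive square-free integer and
`K = ℚ(√-d)` with conjugation `σ`.  For every `π ∈ 𝒥` there are unique integers
`a > 0`, `b` such that `(a + b√-d)/2` is an algebraic integer generating `π²`; the
triple `(N(π), a, b)` is then a primitive solution of `4n² = a² + db²`
(`n, a > 0`, `b ≠ 0`, `gcd(n, a) = 1`); the resulting map is a bijection from `𝒥` onto
the set of primitive solutions; and consequently
`F(d) = min {n > 0 | ∃ a > 0, b ≠ 0, 4n² = a² + db²}`. -/
theorem quadJ_bijection_and_Fquad_eq
    (d : ℕ) (hd : Squarefree d) (hdpos : 0 < d) (hd1 : d ≠ 1) (hd3 : d ≠ 3)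
    (K : Type*) [Field K] [NumberField K]
    (hrank : Module.finrank ℚ K = 2)
    (sqd : K) (hsq : sqd * sqd = -(d : K))
    (σ : K ≃ₐ[ℚ] K) (hσ : σ sqd = -sqd) :
    (∀ π ∈ quadJ K σ,
      ∃! ab : ℤ × ℤ, 0 < ab.1 ∧ ∃ x : 𝓞 K,
        algebraMap (𝓞 K) K x = ((ab.1 : K) + (ab.2 : K) * sqd) / 2 ∧
        Ideal.span {x} = π ^ 2) ∧
    (∀ π ∈ quadJ K σ, ∀ (a b : ℤ) (x : 𝓞 K), 0 < a →
      algebraMap (𝓞 K) K x = ((a : K) + (b : K) * sqd) / 2 →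
      Ideal.span {x} = π ^ 2 →
      (b ≠ 0 ∧ 4 * (Ideal.absNorm π : ℤ) ^ 2 = a ^ 2 + (d : ℤ) * b ^ 2 ∧
        Int.gcd (Ideal.absNorm π : ℤ) a = 1)) ∧
    (∀ n a b : ℤ, 0 < n → 0 < a → b ≠ 0 → 4 * n ^ 2 = a ^ 2 + (d : ℤ) * b ^ 2 →
      Int.gcd n a = 1 →
      ∃! π : Ideal (𝓞 K), π ∈ quadJ K σ ∧ (Ideal.absNorm π : ℤ) = n ∧
        ∃ x : 𝓞 K, algebraMap (𝓞 K) K x = ((a : K) + (b : K) * sqd) / 2 ∧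
          Ideal.span {x} = π ^ 2) ∧
    Fquad K σ = sInf {n : ℕ | 0 < n ∧ ∃ a b : ℤ, 0 < a ∧ b ≠ 0 ∧
      4 * (n : ℤ) ^ 2 = a ^ 2 + (d : ℤ) * b ^ 2} := by
  exact ⟨fun π hπ => existsUnique_generator hd hd1 hd3 hrank hdpos hsq hσ hπ,
    fun π hπ a b x _ hab hx => isPrimitiveSolution_of_mem_quadJ hd hrank hdpos hsq hσ hπ hab hx,
    fun n a b hn _ hb h hgcd =>
      existsUnique_ideal_of_primitiveSolution hd hd1 hd3 hrank hdpos hsq hσ hn hb h hgcd,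
    Fquad_eq_sInf hd hd1 hd3 hrank hdpos hsq hσ⟩
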